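/- The smallest diameter of an RSD set is 30: every nonempty finite RSD set A of integers satisfies max(A) − min(A) ≥ 30, and there exists an RSD set A of integers with max(A) − min(A) = 30. -/

import Mathlib

open Pointwise

/-- The restricted sumset `A +̂ A = {a + b : a, b ∈ A, a ≠ b}`. -/
def restSum (A : Finset ℤ) : Finset ℤ :=
  ((A ×ˢ A).filter (fun p => p.1 ≠ p.2)).image (fun p => p.1 + p.2)

namespace RSD

/-- Truth tables of the `n` boolean variables, as bit masks of length `2^n`. -/
def vars : ℕ → List ℕ
  | 0 => []
  | n+1 => (vars n).map (fun v => Nat.lor v (Nat.shiftLeft v (2^n))) ++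
      [Nat.shiftLeft (2^(2^n) - 1) (2^n)]

/-- Disjunction of the tables selected by the bits of `K`. -/
noncomputable def orSel (l : List ℕ) : ℕ → ℕ :=
  List.rec (motive := fun _ => ℕ → ℕ) (fun _ => 0)
    (fun v _ ih K => cond (Nat.beq K 0) 0
      (cond (Nat.beq (Nat.land K 1) 0) (ih (Nat.shiftRight K 1))
        (Nat.lor v (ih (Nat.shiftRight K 1))))) l

/-- Disjunction of `v_i ∧ v_{f i}`. -/
def orp (vs : List ℕ) (f : ℕ → ℕ) : List ℕ → ℕ
  | [] => 0
  | i :: l => Nat.lor (Nat.land (vs.getD i 0) (vs.getD (f i) 0)) (orp vs f l)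

/-- Tables for the inner differences. -/
def mkD (vs : List ℕ) (n d : ℕ) : List (ℕ × ℕ) :=
  (List.range' 1 d).map fun t => (t, orp vs (fun i => i + t) (List.range n))

/-- Tables for the inner restricted sums. -/
def mkS (vs : List ℕ) (w d : ℕ) : List (ℕ × ℕ) :=
  (List.range' 1 (2 * d - 1)).map fun r =>
    (r, orp vs (fun i => r - 2 * w - i) (List.range ((r - 2 * w + 1) / 2)))

/-- Carry-save addition of a column of bits. -/
def csa : List ℕ → ℕ → List ℕ → ℕ × List ℕ
  | [], s, cs => (s, cs)
  | [x], s, cs => (Nat.xor s x, Nat.land s x :: cs)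
  | x :: y :: l, s, cs =>
      csa l (Nat.xor (Nat.xor s x) y)
        (Nat.lor (Nat.land s x) (Nat.land y (Nat.xor s x)) :: cs)

/-- Mask of the assignments for which the weighted count reaches `q`. -/
def fin : ℕ → ℕ → List ℕ → List ℕ → ℕ → ℕ
  | 0, q, _, _, g => cond (Nat.beq q 0) g 0
  | k+1, q, l1, l2, g =>
      fin k (Nat.shiftRight q 1) ((csa l1 0 []).2 ++ l2) []
        (cond (Nat.beq (Nat.land q 1) 0) (Nat.lor (csa l1 0 []).1 g)
          (Nat.land (csa l1 0 []).1 g))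

noncomputable def sumX (vs : List ℕ) (T K : ℕ) : ℕ := Nat.lor T (orSel vs K)

noncomputable def sums (vs : List ℕ) (M w d I J : ℕ) (acc2 : List ℕ) (l : List (ℕ × ℕ)) :
    ℕ → List ℕ → Bool :=
  List.rec (motive := fun _ => ℕ → List ℕ → Bool)
    (fun q acc => Nat.beq (fin 7 q acc acc2 M) M)
    (fun p _ ih q acc =>
    cond (Nat.beq q 0) true
      (cond (Nat.beq
          (Nat.lor (Nat.land I (Nat.shiftRight (Nat.shiftLeft J p.1) d)) (Nat.shiftLeft 1 (Nat.shiftRight p.1 1)))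
          (Nat.shiftLeft 1 (Nat.shiftRight p.1 1)))
        (cond (Nat.beq (sumX vs p.2 (Nat.shiftRight (Nat.shiftRight (Nat.shiftLeft J p.1) d) w)) 0)
          (ih (Nat.sub q 1) acc)
          (ih q
            (Nat.xor (sumX vs p.2 (Nat.shiftRight (Nat.shiftRight (Nat.shiftLeft J p.1) d) w)) M :: acc)))
        (ih q acc))) l

noncomputable def diffs (vs : List ℕ) (w I : ℕ) (k : ℕ → List ℕ → Bool) (l : List (ℕ × ℕ)) :
    ℕ → List ℕ → Bool :=
  List.rec (motive := fun _ => ℕ → List ℕ → Bool)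
    (fun q acc => k q acc)
    (fun p _ ih q acc =>
    cond (Nat.beq q 0) true
      (cond (Nat.beq (Nat.land I (Nat.shiftRight I p.1)) 0)
        (cond (Nat.beq (sumX vs p.2
            (Nat.shiftRight (Nat.lor (Nat.shiftRight I p.1) (Nat.shiftLeft I p.1)) w)) 0)
          (ih q acc)
          (ih q (sumX vs p.2
            (Nat.shiftRight (Nat.lor (Nat.shiftRight I p.1) (Nat.shiftLeft I p.1)) w) :: acc)))
        (ih (Nat.sub q 2) acc))) l

noncomputable def leaf (vs : List ℕ) (M w d : ℕ) (dl sl : List (ℕ × ℕ)) (I J : ℕ) : Bool :=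
  diffs vs w I (fun q acc2 => sums vs M w d I J acc2 sl q []) dl (2 * d - 2) []

def tree (lf : ℕ → ℕ → Bool) (d : ℕ) : List ℕ → ℕ → ℕ → Bool
  | [], I, J => cond (Nat.ble (Nat.succ J) I) true (lf I J)
  | p :: ps, I, J => cond (tree lf d ps I J)
      (tree lf d ps (Nat.lor I (Nat.shiftLeft 1 p)) (Nat.lor J (Nat.shiftLeft 1 (Nat.sub d p)))) false

/-- The leaf check: `n` inner positions `w, …, w+n-1`. -/
noncomputable def lf' (n w d : ℕ) (vs : List ℕ) : ℕ → ℕ → Bool :=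
  leaf vs (2^(2^n) - 1) w d (mkD vs n d) (mkS vs w d)

/-- The whole check: `n` inner positions, outer free positions `ps`. -/
noncomputable def run (n w d : ℕ) (ps : List ℕ) (I J : ℕ) : Bool :=
  tree (lf' n w d (vars n)) d ps I J

/-! ### Correctness -/

theorem vars_length (n : ℕ) : (vars n).length = n := by
  induction n with
  | zero => rfl
  | succ n ih => simp [vars, ih]

theorem vars_testBit (n : ℕ) : ∀ i < n, ∀ m < 2^n, ((vars n).getD i 0).testBit m = m.testBit i := by
  induction n with
  | zero => intro i hi; omega
  | succ n ih =>
    intro i hi m hm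
    have hl := vars_length n
    have hsl : ∀ a b : ℕ, Nat.shiftLeft a b = a <<< b := fun _ _ => rfl
    have hlo : ∀ a b : ℕ, Nat.lor a b = a ||| b := fun _ _ => rfl
    rw [vars]
    by_cases hin : i < n
    · have h1 : (((vars n).map (fun v => Nat.lor v (Nat.shiftLeft v (2^n))) ++
        [Nat.shiftLeft (2^(2^n) - 1) (2^n)]).getD i 0) =
          Nat.lor ((vars n).getD i 0) (Nat.shiftLeft ((vars n).getD i 0) (2^n)) := by
        have : i < (vars n).length := by omega
        simp [List.getD, List.getElem?_append, this]
      rw [h1, hsl, hlo, Nat.testBit_lor, Nat.testBit_shiftLeft]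
      by_cases hmn : m < 2^n
      · rw [ih i hin m hmn]
        simp; omega
      · have h2 : (m - 2^n) < 2^n := by rw [pow_succ] at hm; omega
        rw [ih i hin _ h2]
        have h3 : ((vars n).getD i 0).testBit m = false := by
          have key : ∀ k, ∀ v ∈ vars k, v < 2^(2^k) := by
            intro k
            induction k with
            | zero => simp [vars]
            | succ k ihk =>
              intro v hv
              simp only [vars, List.mem_append, List.mem_map, List.mem_singleton] at hv
              have e : 2^(2^(k+1)) = 2^(2^k) * 2^(2^k) := by rw [← pow_add]; congr 1; ring
              have hp : 0 < 2^(2^k) := by positivity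
              rcases hv with ⟨a, ha, rfl⟩ | rfl
              · have := ihk a ha
                rw [hsl, hlo]
                apply Nat.or_lt_two_pow
                · rw [e]; nlinarith
                · rw [Nat.shiftLeft_eq, e]; exact Nat.mul_lt_mul_of_pos_right this hp
              · rw [hsl, Nat.shiftLeft_eq, e]; exact Nat.mul_lt_mul_of_pos_right (by omega) hp
          have h4 : (vars n).getD i 0 < 2^(2^n) := by
            have : i < (vars n).length := by omega
            rw [List.getD_eq_getElem _ _ this]
            exact key n _ (List.getElem_mem this)
          apply Nat.testBit_lt_two_pow
          exact lt_of_lt_of_le h4 (Nat.pow_le_pow_right (by norm_num) (by omega))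
        rw [h3]
        have h5 : m = 2^n + (m - 2^n) := by omega
        conv_rhs => rw [h5]
        rw [Nat.testBit_two_pow_add_gt hin]
        simp; omega
    · have hi' : i = n := by omega
      subst hi'
      have h1 : (((vars i).map (fun v => Nat.lor v (Nat.shiftLeft v (2^i))) ++
        [Nat.shiftLeft (2^(2^i) - 1) (2^i)]).getD i 0) = Nat.shiftLeft (2^(2^i) - 1) (2^i) := by
        simp [List.getD, List.getElem?_append, hl]
      rw [h1, hsl, Nat.testBit_shiftLeft, Nat.testBit_two_pow_sub_one]
      by_cases hmn : m < 2^i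
      · rw [Nat.testBit_lt_two_pow hmn]; simp; omega
      · have h5 : m = 2^i + (m - 2^i) := by omega
        have h2 : (m - 2^i) < 2^i := by rw [pow_succ] at hm; omega
        conv_rhs => rw [h5]
        rw [Nat.testBit_two_pow_add_eq, Nat.testBit_lt_two_pow h2]
        simp; omega

theorem hsl (a b : ℕ) : Nat.shiftLeft a b = a <<< b := rfl
theorem hsr (a b : ℕ) : Nat.shiftRight a b = a >>> b := rfl
theorem hlo (a b : ℕ) : Nat.lor a b = a ||| b := rfl
theorem hla (a b : ℕ) : Nat.land a b = a &&& b := rfl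
theorem hxo (a b : ℕ) : Nat.xor a b = a ^^^ b := rfl

theorem orSel_testBit (vs : List ℕ) (m : ℕ) : ∀ K, (orSel vs K).testBit m = true ↔
    ∃ i < vs.length, K.testBit i = true ∧ (vs.getD i 0).testBit m = true := by
  induction vs with
  | nil => intro K; simp [orSel]
  | cons v vs ih =>
    intro K
    have e : orSel (v :: vs) K = cond (Nat.beq K 0) 0
      (cond (Nat.beq (Nat.land K 1) 0) (orSel vs (Nat.shiftRight K 1))
        (Nat.lor v (orSel vs (Nat.shiftRight K 1)))) := rfl
    have ih' := ih (K >>> 1)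
    have split : (∃ i < (v :: vs).length, K.testBit i = true ∧ ((v :: vs).getD i 0).testBit m = true)
        ↔ (K.testBit 0 = true ∧ v.testBit m = true) ∨ (orSel vs (K >>> 1)).testBit m = true := by
      rw [ih']
      constructor
      · rintro ⟨i, hi, h1, h2⟩
        cases i with
        | zero => left; exact ⟨h1, by simpa using h2⟩
        | succ i =>
          right
          refine ⟨i, by simpa using hi, ?_, by simpa using h2⟩
          rw [Nat.testBit_shiftRight, add_comm]; exact h1
      · rintro (⟨h1, h2⟩ | ⟨i, hi, h1, h2⟩)
        · exact ⟨0, by simp, h1, by simpa using h2⟩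
        · refine ⟨i+1, by simpa using hi, ?_, by simpa using h2⟩
          rw [Nat.testBit_shiftRight, add_comm] at h1; exact h1
    rw [split, e, hsr, hla, hlo]
    by_cases hK : K = 0
    · subst hK
      have : (orSel vs 0).testBit m = false := by
        rw [Bool.eq_false_iff]; intro h; rw [ih] at h; simp at h
      simp [this]
    · have hK' : Nat.beq K 0 = false := by rw [Bool.eq_false_iff]; intro h; exact hK (Nat.eq_of_beq_eq_true h)
      rw [hK']
      have h0 : K.testBit 0 = decide (K % 2 = 1) := Nat.testBit_zero K
      rw [Nat.and_one_is_mod]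
      rcases Nat.mod_two_eq_zero_or_one K with h | h
      · simp [h]
      · simp [h, Nat.beq, Nat.testBit_lor]

theorem orp_testBit (vs : List ℕ) (f : ℕ → ℕ) (m : ℕ) (l : List ℕ) :
    (orp vs f l).testBit m = true ↔
      ∃ i ∈ l, (vs.getD i 0).testBit m = true ∧ (vs.getD (f i) 0).testBit m = true := by
  induction l with
  | nil => simp [orp]
  | cons a l ih =>
    rw [orp, hlo, hla, Nat.testBit_lor, Nat.testBit_land, Bool.or_eq_true, ih]
    simp

/-- Number of tables in the list that are true at `m`. -/
def val (m : ℕ) (l : List ℕ) : ℕ := (l.map fun x => (x.testBit m).toNat).sum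

theorem csa_val (m : ℕ) : ∀ (l : List ℕ) (s : ℕ) (cs : List ℕ),
    ((csa l s cs).1.testBit m).toNat + 2 * val m (csa l s cs).2 =
      val m l + (s.testBit m).toNat + 2 * val m cs
  | [], s, cs => by simp [csa, val]
  | [x], s, cs => by
    simp only [csa, val, hxo, hla, List.map_cons, List.map_nil, List.sum_cons, List.sum_nil,
      Nat.testBit_xor, Nat.testBit_land]
    cases s.testBit m <;> cases x.testBit m <;> simp <;> ring
  | x :: y :: l, s, cs => by
    rw [csa, csa_val m l]
    simp only [val, hxo, hla, hlo, List.map_cons, List.sum_cons,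
      Nat.testBit_xor, Nat.testBit_land, Nat.testBit_lor]
    cases s.testBit m <;> cases x.testBit m <;> cases y.testBit m <;> simp <;> ring

theorem fin_spec (m : ℕ) : ∀ (k q : ℕ) (l1 l2 : List ℕ) (g : ℕ),
    (fin k q l1 l2 g).testBit m = true →
      q + (!(g.testBit m)).toNat ≤ val m l1 + 2 * val m l2 := by
  intro k
  induction k with
  | zero =>
    intro q l1 l2 g h
    rw [fin] at h
    by_cases hq : q = 0
    · subst hq
      have : g.testBit m = true := by simpa using h
      simp [this]
    · have hq' : Nat.beq q 0 = false := by rw [Bool.eq_false_iff]; intro h; exact hq (Nat.eq_of_beq_eq_true h)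
      rw [hq'] at h; simp at h
  | succ k ih =>
    intro q l1 l2 g h
    rw [fin] at h
    have h1 := ih _ _ _ _ h
    have h2 := csa_val m l1 0 []
    have h3 : val m ((csa l1 0 []).2 ++ l2) = val m (csa l1 0 []).2 + val m l2 := by simp [val]
    rw [h3] at h1
    have h4 : val m [] = 0 := rfl
    have h5 : Nat.shiftRight q 1 = q / 2 := by rw [hsr, Nat.shiftRight_eq_div_pow]
    rw [h5, hla, hlo, hla, Nat.and_one_is_mod] at h1
    rw [h4] at h1 h2
    rw [Nat.zero_testBit] at h2
    rcases Nat.mod_two_eq_zero_or_one q with hq | hq <;> rw [hq] at h1 <;>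
      simp only [Nat.beq_eq, Nat.beq, Nat.testBit_lor, Nat.testBit_land, cond_true, cond_false] at h1 <;>
      revert h1 h2 <;> cases ((csa l1 0 []).1.testBit m) <;> cases (g.testBit m) <;>
      simp <;> omega

theorem beq_false_of {a b : ℕ} (h : a ≠ b) : Nat.beq a b = false := by
  rw [Bool.eq_false_iff]; intro h'; exact h (Nat.eq_of_beq_eq_true h')

theorem beq_true_of {a b : ℕ} (h : a = b) : Nat.beq a b = true := by
  subst h; exact Nat.beq_refl a

theorem cond_beq_cases {α : Type*} (a b : ℕ) (x y : α) :
    (a = b ∧ cond (Nat.beq a b) x y = x) ∨ (a ≠ b ∧ cond (Nat.beq a b) x y = y) := by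
  by_cases h : a = b
  · left; exact ⟨h, by rw [beq_true_of h]; rfl⟩
  · right; exact ⟨h, by rw [beq_false_of h]; rfl⟩

theorem val_cons (m x : ℕ) (l : List ℕ) : val m (x :: l) = (x.testBit m).toNat + val m l := by
  simp [val]

/-- `t` is a difference of the set with indicator `b`. -/
def Pres (b : ℕ → Bool) (t : ℕ) : Prop := ∃ i, b i = true ∧ b (i + t) = true

/-- `r` is a restricted sum of the set with indicator `b`. -/
def Sm (b : ℕ → Bool) (r : ℕ) : Prop := ∃ i j, i ≠ j ∧ b i = true ∧ b j = true ∧ i + j = r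

open Classical in
theorem diffs_spec (vs : List ℕ) (w I m S : ℕ) (b : ℕ → Bool) (k : ℕ → List ℕ → Bool)
    (hv : ∀ i < vs.length, (vs.getD i 0).testBit m = b (w + i))
    (hI : ∀ i, I.testBit i = true → b i = true)
    (hk : ∀ q acc, k q acc = true → q ≤ 2 * val m acc + S) :
    ∀ (l : List (ℕ × ℕ)) (q : ℕ) (acc : List ℕ),
      (∀ p ∈ l, p.2.testBit m = true → Pres b p.1) → diffs vs w I k l q acc = true →
      q ≤ 2 * val m acc + 2 * l.countP (fun p => decide (Pres b p.1)) + S := by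
  intro l
  induction l with
  | nil => intro q acc _ h; simpa using hk q acc h
  | cons p l ih =>
    intro q acc hl h
    have hl' : ∀ p ∈ l, p.2.testBit m = true → Pres b p.1 := fun p hp => hl p (List.mem_cons_of_mem _ hp)
    have e : diffs vs w I k (p :: l) q acc = cond (Nat.beq q 0) true
      (cond (Nat.beq (Nat.land I (Nat.shiftRight I p.1)) 0)
        (cond (Nat.beq (sumX vs p.2
            (Nat.shiftRight (Nat.lor (Nat.shiftRight I p.1) (Nat.shiftLeft I p.1)) w)) 0)
          (diffs vs w I k l q acc)
          (diffs vs w I k l q (sumX vs p.2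
            (Nat.shiftRight (Nat.lor (Nat.shiftRight I p.1) (Nat.shiftLeft I p.1)) w) :: acc)))
        (diffs vs w I k l (Nat.sub q 2) acc)) := rfl
    rw [e] at h
    clear e
    have hx : (sumX vs p.2
        (Nat.shiftRight (Nat.lor (Nat.shiftRight I p.1) (Nat.shiftLeft I p.1)) w)).testBit m = true →
        Pres b p.1 := by
      intro hh
      rw [sumX, hlo, Nat.testBit_lor, Bool.or_eq_true, orSel_testBit] at hh
      rcases hh with hh | ⟨i, hi, h1, h2⟩
      · exact hl p List.mem_cons_self hh
      · rw [hv i hi] at h2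
        rw [hsr, hlo, hsr, hsl, Nat.testBit_shiftRight, Nat.testBit_lor, Bool.or_eq_true,
          Nat.testBit_shiftRight, Nat.testBit_shiftLeft, Bool.and_eq_true, decide_eq_true_eq] at h1
        rcases h1 with h1 | ⟨h0, h1⟩
        · exact ⟨w + i, h2, by rw [add_comm]; exact hI _ h1⟩
        · exact ⟨w + i - p.1, hI _ h1, by rwa [Nat.sub_add_cancel h0]⟩
    generalize sumX vs p.2
        (Nat.shiftRight (Nat.lor (Nat.shiftRight I p.1) (Nat.shiftLeft I p.1)) w) = x at h hx
    rw [List.countP_cons]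
    rcases cond_beq_cases q 0 true (cond (Nat.beq (Nat.land I (Nat.shiftRight I p.1)) 0)
        (cond (Nat.beq x 0) (diffs vs w I k l q acc) (diffs vs w I k l q (x :: acc)))
        (diffs vs w I k l (Nat.sub q 2) acc)) with ⟨h0, h1⟩ | ⟨-, h1⟩
    · omega
    rw [h1] at h
    rcases cond_beq_cases (Nat.land I (Nat.shiftRight I p.1)) 0
        (cond (Nat.beq x 0) (diffs vs w I k l q acc) (diffs vs w I k l q (x :: acc)))
        (diffs vs w I k l (Nat.sub q 2) acc) with ⟨h0, h1⟩ | ⟨h0, h1⟩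
    · rw [h1] at h
      rcases cond_beq_cases x 0 (diffs vs w I k l q acc) (diffs vs w I k l q (x :: acc)) with
        ⟨h0, h1⟩ | ⟨h0, h1⟩
      · rw [h1] at h
        have := ih _ _ hl' h
        omega
      · rw [h1] at h
        have h2 := ih _ _ hl' h
        rw [val_cons] at h2
        by_cases hp : Pres b p.1
        · have : (x.testBit m).toNat ≤ 1 := Bool.toNat_le _
          simp only [hp, decide_true, if_true]
          omega
        · have : x.testBit m = false := by
            rw [Bool.eq_false_iff]; exact fun h => hp (hx h)
          rw [this] at h2
          simp at h2
          omega
    · rw [h1] at h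
      have h2 := ih _ _ hl' h
      have hp : Pres b p.1 := by
        obtain ⟨i, hi⟩ := Nat.exists_testBit_of_ne_zero h0
        rw [hla, hsr, Nat.testBit_land, Nat.testBit_shiftRight, Bool.and_eq_true] at hi
        exact ⟨i, hI _ hi.1, by rw [add_comm]; exact hI _ hi.2⟩
      simp only [hp, decide_true, if_true]
      have : Nat.sub q 2 = q - 2 := rfl
      omega

open Classical in
theorem sums_spec (vs : List ℕ) (n w d I J m : ℕ) (b : ℕ → Bool) (acc2 : List ℕ)
    (hm : m < 2^n) (hn : vs.length = n)
    (hv : ∀ i < vs.length, (vs.getD i 0).testBit m = b (w + i))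
    (hbd : ∀ i, b i = true → i ≤ d)
    (hI : ∀ i, b i = true → I.testBit i = true ∨ (w ≤ i ∧ i < w + n))
    (hJ : ∀ i, i ≤ d → I.testBit i = true → J.testBit (d - i) = true) :
    ∀ (l : List (ℕ × ℕ)) (q : ℕ) (acc : List ℕ),
      (∀ p ∈ l, (∃ i j, i < j ∧ j < n ∧ b (w + i) = true ∧ b (w + j) = true ∧
        w + i + (w + j) = p.1) → p.2.testBit m = true) →
      sums vs (2^(2^n) - 1) w d I J acc2 l q acc = true →
      q ≤ 2 * val m acc2 + (val m acc + l.countP (fun p => decide (¬ Sm b p.1))) := by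
  intro l
  induction l with
  | nil =>
    intro q acc _ h
    have h1 : fin 7 q acc acc2 (2^(2^n) - 1) = 2^(2^n) - 1 := Nat.eq_of_beq_eq_true h
    have hM : (2^(2^n) - 1).testBit m = true := by
      rw [Nat.testBit_two_pow_sub_one]; simpa using hm
    have h2 := fin_spec m 7 q acc acc2 (2^(2^n) - 1) (by rw [h1]; exact hM)
    rw [hM] at h2
    simp at h2 ⊢
    omega
  | cons p l ih =>
    intro q acc hl h
    obtain ⟨r, T⟩ := p
    have hl' := fun p hp => hl p (List.mem_cons_of_mem (r, T) hp)
    have e : sums vs (2^(2^n) - 1) w d I J acc2 ((r, T) :: l) q acc = cond (Nat.beq q 0) true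
      (cond (Nat.beq
          (Nat.lor (Nat.land I (Nat.shiftRight (Nat.shiftLeft J r) d)) (Nat.shiftLeft 1 (Nat.shiftRight r 1)))
          (Nat.shiftLeft 1 (Nat.shiftRight r 1)))
        (cond (Nat.beq (sumX vs T (Nat.shiftRight (Nat.shiftRight (Nat.shiftLeft J r) d) w)) 0)
          (sums vs (2^(2^n) - 1) w d I J acc2 l (Nat.sub q 1) acc)
          (sums vs (2^(2^n) - 1) w d I J acc2 l q
            (Nat.xor (sumX vs T (Nat.shiftRight (Nat.shiftRight (Nat.shiftLeft J r) d) w)) (2^(2^n) - 1) :: acc)))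
        (sums vs (2^(2^n) - 1) w d I J acc2 l q acc)) := rfl
    rw [e] at h
    clear e
    have hs : ∀ i, i ≤ d → i ≤ r → I.testBit i = true →
        (Nat.shiftRight (Nat.shiftLeft J r) d).testBit (r - i) = true := by
      intro i hi hir hii
      rw [hsr, hsl, Nat.testBit_shiftRight, Nat.testBit_shiftLeft]
      have : d + (r - i) - r = d - i := by omega
      rw [this, hJ i hi hii]
      simp; omega
    generalize Nat.shiftRight (Nat.shiftLeft J r) d = s at h hs
    -- a sum with at least one inner element is detected
    have hmix : ∀ i j, (w ≤ i ∧ i < w + n) → b i = true → I.testBit j = true → j ≤ d → i + j = r →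
        (sumX vs T (Nat.shiftRight s w)).testBit m = true := by
      intro i j hi hbi hj hjd hij
      rw [sumX, hlo, Nat.testBit_lor, Bool.or_eq_true, orSel_testBit]
      right
      refine ⟨i - w, by omega, ?_, ?_⟩
      · rw [hsr, Nat.testBit_shiftRight]
        have : w + (i - w) = r - j := by omega
        rw [this]
        exact hs j hjd (by omega) hj
      · rw [hv _ (by omega)]
        have : w + (i - w) = i := by omega
        rwa [this]
    have hx : (∀ i j, i ≠ j → I.testBit i = true → I.testBit j = true → i + j = r → i ≤ d → j ≤ d →
        False) →
        Sm b r → (sumX vs T (Nat.shiftRight s w)).testBit m = true := by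
      rintro hno ⟨i, j, hij, hbi, hbj, hr⟩
      rcases hI i hbi with h1 | h1 <;> rcases hI j hbj with h2 | h2
      · exact (hno i j hij h1 h2 hr (hbd i hbi) (hbd j hbj)).elim
      · exact hmix j i h2 hbj h1 (hbd i hbi) (by omega)
      · exact hmix i j h1 hbi h2 (hbd j hbj) hr
      · rw [sumX, hlo, Nat.testBit_lor, Bool.or_eq_true]
        left
        apply hl (r, T) List.mem_cons_self
        have ei : w + (i - w) = i := by omega
        have ej : w + (j - w) = j := by omega
        rcases lt_or_gt_of_ne hij with hlt | hlt
        · exact ⟨i - w, j - w, by omega, by omega, by rwa [ei], by rwa [ej], by omega⟩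
        · exact ⟨j - w, i - w, by omega, by omega, by rwa [ej], by rwa [ei], by omega⟩
    generalize sumX vs T (Nat.shiftRight s w) = x at h hx
    rw [List.countP_cons]
    generalize hA : sums vs (2^(2^n) - 1) w d I J acc2 l (Nat.sub q 1) acc = sA at h
    generalize hB : sums vs (2^(2^n) - 1) w d I J acc2 l q (Nat.xor x (2^(2^n) - 1) :: acc) = sB at h
    generalize hC : sums vs (2^(2^n) - 1) w d I J acc2 l q acc = sC at h
    generalize hL : Nat.lor (Nat.land I s) (Nat.shiftLeft 1 (Nat.shiftRight r 1)) = L at h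
    generalize hR : Nat.shiftLeft 1 (Nat.shiftRight r 1) = R at h hL
    rcases cond_beq_cases q 0 true (cond (Nat.beq L R) (cond (Nat.beq x 0) sA sB) sC) with
      ⟨h0, h1⟩ | ⟨-, h1⟩
    · omega
    rw [h1] at h
    rcases cond_beq_cases L R (cond (Nat.beq x 0) sA sB) sC with ⟨h0, h1⟩ | ⟨-, h1⟩
    · rw [h1] at h
      have hno : ∀ i j, i ≠ j → I.testBit i = true → I.testBit j = true → i + j = r → i ≤ d → j ≤ d →
          False := by
        intro i j hij hi hj hr hid hjd
        have key : ∀ k, I.testBit k = true → s.testBit k = true → k = r / 2 := by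
          intro k h1 h2
          have h3 : R.testBit k = true := by
            rw [← h0, ← hL, hlo, hla, Nat.testBit_lor, Nat.testBit_land, h1, h2]; rfl
          rw [← hR, hsl, hsr, Nat.shiftRight_eq_div_pow, Nat.one_shiftLeft, Nat.testBit_two_pow] at h3
          simpa [eq_comm] using h3
        have ki := key i hi (by
          have := hs j hjd (by omega) hj
          rwa [show r - j = i by omega] at this)
        have kj := key j hj (by
          have := hs i hid (by omega) hi
          rwa [show r - i = j by omega] at this)
        omega
      have hx' := hx hno
      rcases cond_beq_cases x 0 sA sB with ⟨h0, h1⟩ | ⟨-, h1⟩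
      · rw [h1] at h
        have h2 := ih (Nat.sub q 1) acc hl' (hA.trans h)
        have hns : ¬ Sm b r := by
          intro hc
          have := hx' hc
          rw [h0] at this
          simp at this
        simp only [hns, not_false_eq_true, decide_true, if_true] at h2 ⊢
        have : Nat.sub q 1 = q - 1 := rfl
        omega
      · rw [h1] at h
        have h2 := ih q (Nat.xor x (2^(2^n) - 1) :: acc) hl' (hB.trans h)
        rw [val_cons, hxo, Nat.testBit_xor, Nat.testBit_two_pow_sub_one] at h2
        by_cases hc : Sm b r
        · rw [hx' hc] at h2
          simp [hm] at h2
          simp [hc]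
          omega
        · have : (x.testBit m ^^ decide (m < 2^n)).toNat ≤ 1 := Bool.toNat_le _
          simp only [hc, not_false_eq_true, decide_true, if_true]
          omega
    · rw [h1] at h
      have h2 := ih q acc hl' (hC.trans h)
      omega

/-- `I` records the outer part of `b` (except for the positions in `ps`), and `J` is its reverse. -/
structure Spec (n w d : ℕ) (b : ℕ → Bool) (ps : List ℕ) (I J : ℕ) : Prop where
  out : ∀ i, i ∉ ps → ¬ (w ≤ i ∧ i < w + n) → I.testBit i = b i
  inn : ∀ i, (i ∈ ps ∨ (w ≤ i ∧ i < w + n)) → I.testBit i = false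
  rev : ∀ i, J.testBit i = (decide (i ≤ d) && I.testBit (d - i))

open Classical in
/-- The inequality expressing that the set is not RSD. -/
def Ineq (d : ℕ) (b : ℕ → Bool) : Prop :=
  2 * d - 2 ≤ 2 * (List.range' 1 d).countP (fun t => decide (Pres b t)) +
    (List.range' 1 (2 * d - 1)).countP (fun r => decide (¬ Sm b r))

theorem leaf_spec (n w d : ℕ) (b : ℕ → Bool) (I J : ℕ) (hs : Spec n w d b [] I J)
    (hbd : ∀ i, b i = true → i ≤ d) (h : lf' n w d (vars n) I J = true) : Ineq d b := by
  classical
  let m := Nat.ofBits (fun i : Fin n => b (w + i))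
  have hm : m < 2^n := Nat.ofBits_lt_two_pow _
  have hmb : ∀ i < n, m.testBit i = b (w + i) := fun i hi => Nat.testBit_ofBits_lt _ _ hi
  have hlen := vars_length n
  have hv : ∀ i < (vars n).length, ((vars n).getD i 0).testBit m = b (w + i) := by
    intro i hi
    rw [vars_testBit n i (by omega) m hm, hmb i (by omega)]
  have hv0 : ∀ i, ((vars n).getD i 0).testBit m = true → i < n ∧ b (w + i) = true := by
    intro i hi
    by_cases hin : i < (vars n).length
    · rw [hv i hin] at hi; exact ⟨by omega, hi⟩
    · rw [List.getD_eq_default _ _ (by omega)] at hi; simp at hi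
  have hI1 : ∀ i, I.testBit i = true → b i = true := by
    intro i hi
    by_cases hw : w ≤ i ∧ i < w + n
    · rw [hs.inn i (Or.inr hw)] at hi; simp at hi
    · rwa [hs.out i (by simp) hw] at hi
  have hI2 : ∀ i, b i = true → I.testBit i = true ∨ (w ≤ i ∧ i < w + n) := by
    intro i hi
    by_cases hw : w ≤ i ∧ i < w + n
    · exact Or.inr hw
    · left; rwa [hs.out i (by simp) hw]
  have hJ : ∀ i, i ≤ d → I.testBit i = true → J.testBit (d - i) = true := by
    intro i hi h
    rw [hs.rev]
    have : d - (d - i) = i := by omega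
    rw [this, h]; simp
  have key := diffs_spec (vars n) w I m
    ((mkS (vars n) w d).countP (fun p => decide (¬ Sm b p.1))) b
    (fun q acc2 => sums (vars n) (2^(2^n) - 1) w d I J acc2 (mkS (vars n) w d) q []) hv hI1
    (by
      intro q acc hk
      have := sums_spec (vars n) n w d I J m b acc hm hlen hv hbd hI2 hJ (mkS (vars n) w d) q []
        (by
          intro p hp
          simp only [mkS, List.mem_map] at hp
          obtain ⟨r, hr, rfl⟩ := hp
          rintro ⟨i, j, hij, hj, hbi, hbj, hsum⟩
          simp only at hsum
          rw [orp_testBit]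
          refine ⟨i, ?_, ?_, ?_⟩
          · rw [List.mem_range]; omega
          · rw [hv i (by omega)]; exact hbi
          · have : r - 2 * w - i = j := by omega
            rw [this, hv j (by omega)]; exact hbj) hk
      have h0 : val m [] = 0 := rfl
      omega)
    (mkD (vars n) n d) (2 * d - 2) []
    (by
      intro p hp
      simp only [mkD, List.mem_map] at hp
      obtain ⟨t, ht, rfl⟩ := hp
      intro hT
      rw [orp_testBit] at hT
      obtain ⟨i, hi, h1, h2⟩ := hT
      exact ⟨w + i, (hv0 _ h1).2, by rw [add_assoc]; exact (hv0 _ h2).2⟩) h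
  have h0 : val m [] = 0 := rfl
  rw [h0] at key
  have e1 : (mkD (vars n) n d).countP (fun p => decide (Pres b p.1)) =
      (List.range' 1 d).countP (fun t => decide (Pres b t)) := by
    rw [mkD, List.countP_map]; rfl
  have e2 : (mkS (vars n) w d).countP (fun p => decide (¬ Sm b p.1)) =
      (List.range' 1 (2 * d - 1)).countP (fun r => decide (¬ Sm b r)) := by
    rw [mkS, List.countP_map]; rfl
  rw [e1, e2] at key
  unfold Ineq
  omega

theorem tree_spec (lf : ℕ → ℕ → Bool) (n w d : ℕ) (b : ℕ → Bool) :
    ∀ (ps : List ℕ) (I J : ℕ), ps.Nodup → (∀ p ∈ ps, p ≤ d ∧ ¬ (w ≤ p ∧ p < w + n)) →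
      Spec n w d b ps I J → tree lf d ps I J = true →
      ∃ I' J', Spec n w d b [] I' J' ∧ (J' < I' ∨ lf I' J' = true) := by
  intro ps
  induction ps with
  | nil =>
    intro I J _ _ hs h
    refine ⟨I, J, hs, ?_⟩
    rw [tree] at h
    by_cases hc : J < I
    · exact Or.inl hc
    · right
      have : Nat.ble (Nat.succ J) I = false := by
        rw [Bool.eq_false_iff]; intro h'; exact hc (Nat.le_of_ble_eq_true h')
      rwa [this] at h
  | cons p ps ih =>
    intro I J hnd hps hs h
    rw [tree] at h
    rw [List.nodup_cons] at hnd
    have hp := hps p List.mem_cons_self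
    have hps' : ∀ p ∈ ps, p ≤ d ∧ ¬ (w ≤ p ∧ p < w + n) := fun q hq => hps q (List.mem_cons_of_mem _ hq)
    have h1 : tree lf d ps I J = true := by
      cases hh : tree lf d ps I J
      · rw [hh] at h; simp at h
      · rfl
    rw [h1] at h
    have h2 : tree lf d ps (Nat.lor I (Nat.shiftLeft 1 p))
      (Nat.lor J (Nat.shiftLeft 1 (Nat.sub d p))) = true := h
    have hIp := hs.inn p (Or.inl List.mem_cons_self)
    cases hb : b p
    · refine ih I J hnd.2 hps' ⟨?_, ?_, hs.rev⟩ h1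
      · intro i hi hw
        by_cases hip : i = p
        · rw [hip, hIp, hb]
        · exact hs.out i (by simp [hip, hi]) hw
      · intro i hi
        apply hs.inn
        rcases hi with hi | hi
        · exact Or.inl (List.mem_cons_of_mem _ hi)
        · exact Or.inr hi
    · refine ih _ _ hnd.2 hps' ⟨?_, ?_, ?_⟩ h2
      · intro i hi hw
        rw [hlo, hsl, Nat.testBit_lor, Nat.one_shiftLeft, Nat.testBit_two_pow]
        by_cases hip : i = p
        · rw [hip, hb]; simp
        · rw [hs.out i (by simp [hip, hi]) hw]
          have : p ≠ i := fun h => hip h.symm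
          simp [this]
      · intro i hi
        rw [hlo, hsl, Nat.testBit_lor, Nat.one_shiftLeft, Nat.testBit_two_pow]
        have h3 : I.testBit i = false := by
          apply hs.inn
          rcases hi with hi | hi
          · exact Or.inl (List.mem_cons_of_mem _ hi)
          · exact Or.inr hi
        have h4 : p ≠ i := by
          rintro rfl
          rcases hi with hi | hi
          · exact hnd.1 hi
          · exact hp.2 hi
        rw [h3]; simp [h4]
      · intro i
        have hsub : Nat.sub d p = d - p := rfl
        rw [hlo, hlo, hsl, hsl, hsub, Nat.testBit_lor, Nat.testBit_lor, Nat.one_shiftLeft,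
          Nat.one_shiftLeft, Nat.testBit_two_pow, Nat.testBit_two_pow, hs.rev]
        by_cases hid : i ≤ d
        · have : (d - p = i) ↔ (p = d - i) := by omega
          simp [hid, this]
        · have : ¬ (d - p = i) := by omega
          simp [hid, this]

theorem run_spec (n w d : ℕ) (ps : List ℕ) (hd : 1 ≤ d) (hnd : ps.Nodup)
    (hps : ∀ p ∈ ps, 1 ≤ p ∧ p < d ∧ ¬ (w ≤ p ∧ p < w + n)) (hw : 1 ≤ w) (hwn : w + n ≤ d)
    (hcov : ∀ p < d, 1 ≤ p → ¬ (w ≤ p ∧ p < w + n) → p ∈ ps)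
    (h : run n w d ps (2^d + 1) (2^d + 1) = true)
    (b : ℕ → Bool) (h0 : b 0 = true) (hbd : b d = true) (hb : ∀ i, b i = true → i ≤ d) :
    ∃ I J, Spec n w d b [] I J ∧ (J < I ∨ Ineq d b) := by
  have ht : ∀ i, (2^d + 1).testBit i = (decide (i = 0) || decide (i = d)) := by
    intro i
    have : 2^d + 1 = 2^d ||| 2^0 := by
      have := Nat.two_pow_add_eq_or_of_lt (i := d) (b := 1) (Nat.one_lt_two_pow (by omega)) 1
      simpa using this
    rw [this, Nat.testBit_lor, Nat.testBit_two_pow, Nat.testBit_two_pow, Bool.or_comm]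
    simp only [eq_comm]
  obtain ⟨I, J, hs, hh⟩ := tree_spec (lf' n w d (vars n)) n w d b ps (2^d+1) (2^d+1) hnd
    (fun p hp => ⟨(hps p hp).2.1.le, (hps p hp).2.2⟩)
    ⟨by
      intro i hi hwi
      rw [ht]
      by_cases e0 : i = 0
      · subst e0; simp [h0]
      by_cases ed : i = d
      · subst ed; simp [hbd]
      by_cases hid : i < d
      · exact absurd (hcov i hid (by omega) hwi) hi
      · have : b i = false := by
          rw [Bool.eq_false_iff]; intro hc; have := hb i hc; omega
        simp [this, e0, ed], by
      intro i hi
      rw [ht]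
      have : i ≠ 0 ∧ i ≠ d := by
        rcases hi with hi | hi
        · have := hps i hi; omega
        · omega
      simp [this.1, this.2], by
      intro i
      rw [ht, ht, Bool.eq_iff_iff]
      simp
      omega⟩ h
  refine ⟨I, J, hs, ?_⟩
  rcases hh with hh | hh
  · exact Or.inl hh
  · exact Or.inr (leaf_spec n w d b I J hs hb hh)

/-- Up to reflection, the set is not RSD. -/
theorem run_spec' (n w d : ℕ) (ps : List ℕ) (hd : 1 ≤ d) (hnd : ps.Nodup)
    (hps : ∀ p ∈ ps, 1 ≤ p ∧ p < d ∧ ¬ (w ≤ p ∧ p < w + n)) (hw : 1 ≤ w) (hwn : 2 * w + n = d + 1)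
    (hcov : ∀ p < d, 1 ≤ p → ¬ (w ≤ p ∧ p < w + n) → p ∈ ps)
    (h : run n w d ps (2^d + 1) (2^d + 1) = true)
    (b b' : ℕ → Bool) (h0 : b 0 = true) (hbd : b d = true) (hb : ∀ i, b i = true → i ≤ d)
    (hb' : ∀ i, b' i = (decide (i ≤ d) && b (d - i))) :
    Ineq d b ∨ Ineq d b' := by
  obtain ⟨I, J, hs, hh⟩ := run_spec n w d ps hd hnd hps hw (by omega) hcov h b h0 hbd hb
  obtain ⟨I', J', hs', hh'⟩ := run_spec n w d ps hd hnd hps hw (by omega) hcov h b'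
    (by rw [hb']; simp [hbd]) (by rw [hb']; simp [h0]) (by intro i hi; rw [hb'] at hi; simp at hi; exact hi.1)
  have e1 : I' = J := by
    apply Nat.eq_of_testBit_eq
    intro i
    rw [hs.rev]
    by_cases hid : i ≤ d
    · by_cases hwi : w ≤ i ∧ i < w + n
      · rw [hs'.inn i (Or.inr hwi), hs.inn (d - i) (Or.inr (by omega))]; simp
      · rw [hs'.out i (by simp) hwi, hs.out (d - i) (by simp) (by omega), hb']
    · rw [hs'.out i (by simp) (by omega), hb']; simp [hid]
  have e2 : J' = I := by
    apply Nat.eq_of_testBit_eq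
    intro i
    rw [hs'.rev, e1, hs.rev]
    by_cases hid : i ≤ d
    · have : d - (d - i) = i := by omega
      simp [hid, this]
    · rw [hs.out i (by simp) (by omega)]
      have : b i = false := by
        rw [Bool.eq_false_iff]; intro hc; exact hid (hb i hc)
      simp [this, hid]
  rcases hh with hh | hh
  · rcases hh' with hh' | hh'
    · omega
    · exact Or.inr hh'
  · exact Or.inl hh

theorem card_le (A : Finset ℤ) (m0 : ℤ) (d : ℕ) (hd : 1 ≤ d) (hm0 : m0 ∈ A)
    (hA : ∀ x ∈ A, m0 ≤ x ∧ x ≤ m0 + d) (h : Ineq d (fun i => decide (m0 + (i : ℤ) ∈ A))) :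
    (restSum A).card ≤ (A - A).card := by
  classical
  set b : ℕ → Bool := fun i => decide (m0 + (i : ℤ) ∈ A) with hb
  have hbi : ∀ x ∈ A, ∃ i : ℕ, i ≤ d ∧ x = m0 + i ∧ b i = true := by
    intro x hx
    have := hA x hx
    refine ⟨(x - m0).toNat, by omega, by omega, ?_⟩
    have e : m0 + ((x - m0).toNat : ℤ) = x := by omega
    simp only [hb, e, hx, decide_true]
  have hib : ∀ i, b i = true → m0 + (i : ℤ) ∈ A := by
    intro i hi; simpa [hb] using hi
  unfold Ineq at h
  set T := ((List.range' 1 d).filter (fun t => decide (Pres b t))).toFinset with hT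
  set R := ((List.range' 1 (2 * d - 1)).filter (fun r => decide (Sm b r))).toFinset with hR
  have cT : T.card = (List.range' 1 d).countP (fun t => decide (Pres b t)) := by
    rw [hT, List.toFinset_card_of_nodup ((List.nodup_range' (step := 1)).filter _), List.countP_eq_length_filter]
  have cR : R.card = (List.range' 1 (2 * d - 1)).countP (fun r => decide (Sm b r)) := by
    rw [hR, List.toFinset_card_of_nodup ((List.nodup_range' (step := 1)).filter _), List.countP_eq_length_filter]
  have cR2 : R.card + (List.range' 1 (2 * d - 1)).countP (fun r => decide (¬ Sm b r)) = 2 * d - 1 := by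
    have := List.length_eq_countP_add_countP (fun r => decide (Sm b r)) (l := List.range' 1 (2 * d - 1))
    rw [List.length_range'] at this
    rw [cR]
    convert this.symm using 3
    simp
  have h1 : (restSum A).card ≤ R.card := by
    have hsub : restSum A ⊆ R.image (fun r : ℕ => 2 * m0 + (r : ℤ)) := by
      intro x hx
      simp only [restSum, Finset.mem_image, Finset.mem_filter, Finset.mem_product] at hx
      obtain ⟨⟨x1, x2⟩, ⟨⟨hx1, hx2⟩, hne⟩, rfl⟩ := hx
      simp only at hx1 hx2 hne
      obtain ⟨i, hi, rfl, hbi1⟩ := hbi x1 hx1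
      obtain ⟨j, hj, rfl, hbj1⟩ := hbi x2 hx2
      have hij : i ≠ j := by rintro rfl; exact hne rfl
      rw [Finset.mem_image]
      refine ⟨i + j, ?_, by push_cast; ring⟩
      rw [hR, List.mem_toFinset, List.mem_filter, List.mem_range'_1]
      exact ⟨by omega, by simpa using ⟨i, j, hij, hbi1, hbj1, rfl⟩⟩
    exact (Finset.card_le_card hsub).trans Finset.card_image_le
  have h2 : 2 * T.card + 1 ≤ (A - A).card := by
    have hT1 : ∀ t ∈ T, 1 ≤ t ∧ Pres b t := by
      intro t ht
      rw [hT, List.mem_toFinset, List.mem_filter, List.mem_range'_1] at ht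
      exact ⟨ht.1.1, by simpa using ht.2⟩
    have hinj1 : Function.Injective (fun t : ℕ => (t : ℤ)) := fun a b h => by simpa using h
    have hinj2 : Function.Injective (fun t : ℕ => -(t : ℤ)) := fun a b h => by simpa using h
    have hsub : insert 0 (T.image (fun t : ℕ => (t : ℤ)) ∪ T.image (fun t : ℕ => -(t : ℤ))) ⊆ A - A := by
      intro x hx
      simp only [Finset.mem_insert, Finset.mem_union, Finset.mem_image] at hx
      rw [Finset.mem_sub]
      rcases hx with rfl | ⟨t, ht, rfl⟩ | ⟨t, ht, rfl⟩
      · exact ⟨m0, hm0, m0, hm0, by ring⟩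
      · obtain ⟨i, h1, h2⟩ := (hT1 t ht).2
        exact ⟨_, hib _ h2, _, hib _ h1, by push_cast; ring⟩
      · obtain ⟨i, h1, h2⟩ := (hT1 t ht).2
        exact ⟨_, hib _ h1, _, hib _ h2, by push_cast; ring⟩
    have hc := Finset.card_le_card hsub
    rw [Finset.card_insert_of_notMem, Finset.card_union_of_disjoint,
      Finset.card_image_of_injective _ hinj1, Finset.card_image_of_injective _ hinj2] at hc
    · omega
    · rw [Finset.disjoint_left]
      intro x hx hx'
      simp only [Finset.mem_image] at hx hx'
      obtain ⟨t, ht, rfl⟩ := hx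
      obtain ⟨t', ht', h⟩ := hx'
      have := (hT1 t ht).1
      omega
    · intro hx
      simp only [Finset.mem_union, Finset.mem_image] at hx
      rcases hx with ⟨t, ht, h⟩ | ⟨t, ht, h⟩ <;> · have := (hT1 t ht).1; omega
  omega

theorem restSum_neg (A : Finset ℤ) : restSum (-A) = -(restSum A) := by
  ext x
  simp only [restSum, Finset.mem_neg', Finset.mem_image, Finset.mem_filter, Finset.mem_product]
  constructor
  · rintro ⟨⟨a, b⟩, ⟨⟨h1, h2⟩, h3⟩, rfl⟩
    exact ⟨(-a, -b), ⟨⟨h1, h2⟩, by simpa using h3⟩, by simp; ring⟩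
  · rintro ⟨⟨a, b⟩, ⟨⟨h1, h2⟩, h3⟩, h⟩
    refine ⟨(-a, -b), ⟨⟨by simpa using h1, by simpa using h2⟩, by simpa using h3⟩, ?_⟩
    simp only at h ⊢
    linarith

/-- No set of diameter `d` is RSD. -/
def Good (d : ℕ) : Prop := ∀ b b' : ℕ → Bool, b 0 = true → b d = true →
  (∀ i, b i = true → i ≤ d) → (∀ i, b' i = (decide (i ≤ d) && b (d - i))) → Ineq d b ∨ Ineq d b'

theorem good_card (d : ℕ) (hd : 1 ≤ d) (hg : Good d) (A : Finset ℤ) (m0 : ℤ) (hm0 : m0 ∈ A)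
    (hm1 : m0 + d ∈ A) (hA : ∀ x ∈ A, m0 ≤ x ∧ x ≤ m0 + d) :
    (restSum A).card ≤ (A - A).card := by
  rcases hg (fun i => decide (m0 + (i : ℤ) ∈ A)) (fun i => decide (-(m0 + d) + (i : ℤ) ∈ -A))
    (by simpa using hm0) (by simpa using hm1)
    (by intro i hi; have := hA _ (of_decide_eq_true hi); omega)
    (by
      intro i
      have e : (-(m0 + d) + (i : ℤ) ∈ -A) ↔ m0 + d - i ∈ A := by
        rw [Finset.mem_neg']
        have : -(-(m0 + d) + (i : ℤ)) = m0 + d - i := by ring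
        rw [this]
      by_cases hid : i ≤ d
      · have e2 : m0 + ((d - i : ℕ) : ℤ) = m0 + d - i := by omega
        simp only [e, e2, hid, decide_true, Bool.true_and]
      · have : ¬ (m0 + d - i ∈ A) := fun hc => by have := hA _ hc; omega
        simp only [e, this, hid, decide_false, Bool.false_and]) with h | h
  · exact card_le A m0 d hd hm0 hA h
  · have h3 := card_le (-A) (-(m0 + d)) d hd (by simpa [Finset.mem_neg'] using hm1)
      (by intro x hx; rw [Finset.mem_neg'] at hx; have := hA _ hx; omega) h
    have e : (-A) - (-A) = -(A - A) := by rw [neg_sub_neg]; rw [neg_sub]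
    rw [restSum_neg, Finset.card_neg, e, Finset.card_neg] at h3
    exact h3

theorem run_cons {n w d : ℕ} {ps : List ℕ} {p I J I' J' : ℕ} (h1 : run n w d ps I J = true)
    (h2 : run n w d ps I' J' = true) (hI : Nat.lor I (Nat.shiftLeft 1 p) = I')
    (hJ : Nat.lor J (Nat.shiftLeft 1 (Nat.sub d p)) = J') : run n w d (p :: ps) I J = true := by
  subst hI hJ
  have e : run n w d (p :: ps) I J = cond (run n w d ps I J) (run n w d ps
    (Nat.lor I (Nat.shiftLeft 1 p)) (Nat.lor J (Nat.shiftLeft 1 (Nat.sub d p)))) false := rfl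
  rw [e, h1, h2]; rfl

theorem good_of (n w d : ℕ) (ps : List ℕ)
    (hs : 1 ≤ d ∧ ps.Nodup ∧ (∀ p ∈ ps, 1 ≤ p ∧ p < d ∧ ¬ (w ≤ p ∧ p < w + n)) ∧ 1 ≤ w ∧
      2 * w + n = d + 1 ∧ (∀ p < d, 1 ≤ p → ¬ (w ≤ p ∧ p < w + n) → p ∈ ps))
    (h : run n w d ps (2^d + 1) (2^d + 1) = true) : Good d :=
  fun b b' h0 hd hb hb' => run_spec' n w d ps hs.1 hs.2.1 hs.2.2.1 hs.2.2.2.1 hs.2.2.2.2.1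
    hs.2.2.2.2.2 h b b' h0 hd hb hb'

/-! ### The computation -/

set_option maxRecDepth 100000

theorem runs :
    run 0 1 1 [] 3 3 = true ∧
    run 1 1 2 [] 5 5 = true ∧
    run 2 1 3 [] 9 9 = true ∧
    run 3 1 4 [] 17 17 = true ∧
    run 4 1 5 [] 33 33 = true ∧
    run 5 1 6 [] 65 65 = true ∧
    run 6 1 7 [] 129 129 = true ∧
    run 7 1 8 [] 257 257 = true ∧
    run 8 1 9 [] 513 513 = true ∧
    run 9 1 10 [] 1025 1025 = true ∧
    run 10 1 11 [] 2049 2049 = true ∧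
    run 11 1 12 [] 4097 4097 = true ∧
    run 12 1 13 [] 8193 8193 = true ∧
    run 13 1 14 [] 16385 16385 = true ∧
    run 14 1 15 [] 32769 32769 = true ∧
    run 15 1 16 [] 65537 65537 = true ∧
    run 16 1 17 [] 131073 131073 = true ∧
    run 17 1 18 [] 262145 262145 = true ∧
    run 18 1 19 [] 524289 524289 = true ∧
    run 19 1 20 [] 1048577 1048577 = true ∧
    run 20 1 21 [] 2097153 2097153 = true ∧
    run 19 2 22 [1, 21] 4194305 4194305 = true ∧
    run 20 2 23 [1, 22] 8388609 8388609 = true ∧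
    run 19 3 24 [1, 23, 2, 22] 16777217 16777217 = true ∧
    run 20 3 25 [1, 24, 2, 23] 33554433 33554433 = true ∧
    run 19 4 26 [2, 24, 3, 23] 67108865 67108865 = true ∧
    run 19 4 26 [2, 24, 3, 23] 100663297 67108867 = true ∧
    run 19 4 26 [2, 24, 3, 23] 67108867 100663297 = true ∧
    run 19 4 26 [2, 24, 3, 23] 100663299 100663299 = true ∧
    run 20 4 27 [2, 25, 3, 24] 134217729 134217729 = true ∧
    run 20 4 27 [2, 25, 3, 24] 201326593 134217731 = true ∧
    run 20 4 27 [2, 25, 3, 24] 134217731 201326593 = true ∧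
    run 20 4 27 [2, 25, 3, 24] 201326595 201326595 = true ∧
    run 19 5 28 [3, 25, 4, 24] 268435457 268435457 = true ∧
    run 19 5 28 [3, 25, 4, 24] 335544321 268435461 = true ∧
    run 19 5 28 [3, 25, 4, 24] 268435461 335544321 = true ∧
    run 19 5 28 [3, 25, 4, 24] 335544325 335544325 = true ∧
    run 19 5 28 [3, 25, 4, 24] 402653185 268435459 = true ∧
    run 19 5 28 [3, 25, 4, 24] 469762049 268435463 = true ∧
    run 19 5 28 [3, 25, 4, 24] 402653189 335544323 = true ∧
    run 19 5 28 [3, 25, 4, 24] 469762053 335544327 = true ∧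
    run 19 5 28 [3, 25, 4, 24] 268435459 402653185 = true ∧
    run 19 5 28 [3, 25, 4, 24] 335544323 402653189 = true ∧
    run 19 5 28 [3, 25, 4, 24] 268435463 469762049 = true ∧
    run 19 5 28 [3, 25, 4, 24] 335544327 469762053 = true ∧
    run 19 5 28 [3, 25, 4, 24] 402653187 402653187 = true ∧
    run 19 5 28 [3, 25, 4, 24] 469762051 402653191 = true ∧
    run 19 5 28 [3, 25, 4, 24] 402653191 469762051 = true ∧
    run 19 5 28 [3, 25, 4, 24] 469762055 469762055 = true ∧
    run 20 5 29 [3, 26, 4, 25] 536870913 536870913 = true ∧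
    run 20 5 29 [3, 26, 4, 25] 671088641 536870917 = true ∧
    run 20 5 29 [3, 26, 4, 25] 536870917 671088641 = true ∧
    run 20 5 29 [3, 26, 4, 25] 671088645 671088645 = true ∧
    run 20 5 29 [3, 26, 4, 25] 805306369 536870915 = true ∧
    run 20 5 29 [3, 26, 4, 25] 939524097 536870919 = true ∧
    run 20 5 29 [3, 26, 4, 25] 805306373 671088643 = true ∧
    run 20 5 29 [3, 26, 4, 25] 939524101 671088647 = true ∧
    run 20 5 29 [3, 26, 4, 25] 536870915 805306369 = true ∧
    run 20 5 29 [3, 26, 4, 25] 671088643 805306373 = true ∧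
    run 20 5 29 [3, 26, 4, 25] 536870919 939524097 = true ∧
    run 20 5 29 [3, 26, 4, 25] 671088647 939524101 = true ∧
    run 20 5 29 [3, 26, 4, 25] 805306371 805306371 = true ∧
    run 20 5 29 [3, 26, 4, 25] 939524099 805306375 = true ∧
    run 20 5 29 [3, 26, 4, 25] 805306375 939524099 = true ∧
    run 20 5 29 [3, 26, 4, 25] 939524103 939524103 = true := by
  refine ⟨?_, ?_, ?_, ?_, ?_, ?_, ?_, ?_, ?_, ?_, ?_, ?_, ?_, ?_, ?_, ?_, ?_, ?_, ?_, ?_, ?_, ?_, ?_, ?_, ?_, ?_, ?_, ?_, ?_, ?_, ?_, ?_, ?_, ?_, ?_, ?_, ?_, ?_, ?_, ?_, ?_, ?_, ?_, ?_, ?_, ?_, ?_, ?_, ?_, ?_, ?_, ?_, ?_, ?_, ?_, ?_, ?_, ?_, ?_, ?_, ?_, ?_, ?_, ?_, ?_⟩ <;> decide +kernel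

theorem good_all (d : ℕ) (h1 : 1 ≤ d) (h2 : d < 30) : Good d := by
  obtain ⟨
    r1_0, r2_0, r3_0, r4_0, r5_0, r6_0,
    r7_0, r8_0, r9_0, r10_0, r11_0, r12_0,
    r13_0, r14_0, r15_0, r16_0, r17_0, r18_0,
    r19_0, r20_0, r21_0, r22_0, r23_0, r24_0,
    r25_0, r26_0, r26_1, r26_2, r26_3, r27_0,
    r27_1, r27_2, r27_3, r28_0, r28_1, r28_2,
    r28_3, r28_4, r28_5, r28_6, r28_7, r28_8,
    r28_9, r28_10, r28_11, r28_12, r28_13, r28_14,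
    r28_15, r29_0, r29_1, r29_2, r29_3, r29_4,
    r29_5, r29_6, r29_7, r29_8, r29_9, r29_10,
    r29_11, r29_12, r29_13, r29_14, r29_15⟩ := runs
  interval_cases d
  · exact good_of 0 1 1 [] (by decide +kernel)
      r1_0
  · exact good_of 1 1 2 [] (by decide +kernel)
      r2_0
  · exact good_of 2 1 3 [] (by decide +kernel)
      r3_0
  · exact good_of 3 1 4 [] (by decide +kernel)
      r4_0
  · exact good_of 4 1 5 [] (by decide +kernel)
      r5_0
  · exact good_of 5 1 6 [] (by decide +kernel)
      r6_0
  · exact good_of 6 1 7 [] (by decide +kernel)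
      r7_0
  · exact good_of 7 1 8 [] (by decide +kernel)
      r8_0
  · exact good_of 8 1 9 [] (by decide +kernel)
      r9_0
  · exact good_of 9 1 10 [] (by decide +kernel)
      r10_0
  · exact good_of 10 1 11 [] (by decide +kernel)
      r11_0
  · exact good_of 11 1 12 [] (by decide +kernel)
      r12_0
  · exact good_of 12 1 13 [] (by decide +kernel)
      r13_0
  · exact good_of 13 1 14 [] (by decide +kernel)
      r14_0
  · exact good_of 14 1 15 [] (by decide +kernel)
      r15_0
  · exact good_of 15 1 16 [] (by decide +kernel)
      r16_0
  · exact good_of 16 1 17 [] (by decide +kernel)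
      r17_0
  · exact good_of 17 1 18 [] (by decide +kernel)
      r18_0
  · exact good_of 18 1 19 [] (by decide +kernel)
      r19_0
  · exact good_of 19 1 20 [] (by decide +kernel)
      r20_0
  · exact good_of 20 1 21 [] (by decide +kernel)
      r21_0
  · exact good_of 19 2 22 [1, 21] (by decide +kernel)
      r22_0
  · exact good_of 20 2 23 [1, 22] (by decide +kernel)
      r23_0
  · exact good_of 19 3 24 [1, 23, 2, 22] (by decide +kernel)
      r24_0
  · exact good_of 20 3 25 [1, 24, 2, 23] (by decide +kernel)
      r25_0
  · exact good_of 19 4 26 [1, 25, 2, 24, 3, 23] (by decide +kernel)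
      (run_cons (run_cons r26_0 r26_1
      (by decide +kernel) (by decide +kernel)) (run_cons r26_2 r26_3
      (by decide +kernel) (by decide +kernel))
      (by decide +kernel) (by decide +kernel))
  · exact good_of 20 4 27 [1, 26, 2, 25, 3, 24] (by decide +kernel)
      (run_cons (run_cons r27_0 r27_1
      (by decide +kernel) (by decide +kernel)) (run_cons r27_2 r27_3
      (by decide +kernel) (by decide +kernel))
      (by decide +kernel) (by decide +kernel))
  · exact good_of 19 5 28 [1, 27, 2, 26, 3, 25, 4, 24] (by decide +kernel)
      (run_cons (run_cons (run_cons (run_cons r28_0 r28_1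
      (by decide +kernel) (by decide +kernel)) (run_cons r28_2 r28_3
      (by decide +kernel) (by decide +kernel))
      (by decide +kernel) (by decide +kernel)) (run_cons (run_cons r28_4 r28_5
      (by decide +kernel) (by decide +kernel)) (run_cons r28_6 r28_7
      (by decide +kernel) (by decide +kernel))
      (by decide +kernel) (by decide +kernel))
      (by decide +kernel) (by decide +kernel)) (run_cons (run_cons (run_cons r28_8 r28_9
      (by decide +kernel) (by decide +kernel)) (run_cons r28_10 r28_11
      (by decide +kernel) (by decide +kernel))
      (by decide +kernel) (by decide +kernel)) (run_cons (run_cons r28_12 r28_13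
      (by decide +kernel) (by decide +kernel)) (run_cons r28_14 r28_15
      (by decide +kernel) (by decide +kernel))
      (by decide +kernel) (by decide +kernel))
      (by decide +kernel) (by decide +kernel))
      (by decide +kernel) (by decide +kernel))
  · exact good_of 20 5 29 [1, 28, 2, 27, 3, 26, 4, 25] (by decide +kernel)
      (run_cons (run_cons (run_cons (run_cons r29_0 r29_1
      (by decide +kernel) (by decide +kernel)) (run_cons r29_2 r29_3
      (by decide +kernel) (by decide +kernel))
      (by decide +kernel) (by decide +kernel)) (run_cons (run_cons r29_4 r29_5
      (by decide +kernel) (by decide +kernel)) (run_cons r29_6 r29_7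
      (by decide +kernel) (by decide +kernel))
      (by decide +kernel) (by decide +kernel))
      (by decide +kernel) (by decide +kernel)) (run_cons (run_cons (run_cons r29_8 r29_9
      (by decide +kernel) (by decide +kernel)) (run_cons r29_10 r29_11
      (by decide +kernel) (by decide +kernel))
      (by decide +kernel) (by decide +kernel)) (run_cons (run_cons r29_12 r29_13
      (by decide +kernel) (by decide +kernel)) (run_cons r29_14 r29_15
      (by decide +kernel) (by decide +kernel))
      (by decide +kernel) (by decide +kernel))
      (by decide +kernel) (by decide +kernel))
      (by decide +kernel) (by decide +kernel))

end RSD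

theorem smallest_rsd_diameter :
    (∀ A : Finset ℤ, ∀ hA : A.Nonempty, (A - A).card < (restSum A).card →
      30 ≤ A.max' hA - A.min' hA) ∧
    (∃ A : Finset ℤ, ∃ hA : A.Nonempty, (A - A).card < (restSum A).card ∧
      A.max' hA - A.min' hA = 30) := by
  constructor
  · intro A hA h
    by_contra hlt
    have hle : A.min' hA ≤ A.max' hA := A.min'_le _ (A.max'_mem hA)
    have hb : ∀ x ∈ A, A.min' hA ≤ x ∧ x ≤ A.max' hA := fun x hx => ⟨A.min'_le x hx, A.le_max' x hx⟩
    have hmin := A.min'_mem hA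
    have hmax := A.max'_mem hA
    generalize A.min' hA = m0 at *
    generalize A.max' hA = m1 at *
    obtain ⟨d, rfl⟩ : ∃ d : ℕ, m1 = m0 + d := ⟨(m1 - m0).toNat, by omega⟩
    rcases Nat.eq_zero_or_pos d with hd | hd
    · subst hd
      have : restSum A = ∅ := by
        rw [Finset.eq_empty_iff_forall_notMem]
        intro x hx
        simp only [restSum, Finset.mem_image, Finset.mem_filter, Finset.mem_product] at hx
        obtain ⟨⟨a, b⟩, ⟨⟨h1, h2⟩, h3⟩, -⟩ := hx
        have h4 := hb _ h1
        have h5 := hb _ h2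
        apply h3
        simp only at *
        omega
      rw [this] at h
      simp at h
    · have := RSD.good_card d hd (RSD.good_all d hd (by omega)) A m0 hmin hmax hb
      omega
  · refine ⟨{0, 1, 2, 3, 6, 8, 13, 16, 18, 23, 24, 26, 28, 29, 30},
      ⟨0, by decide⟩, ?_, ?_⟩
    · decide +kernel
    · decide +kernel
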